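/- Fix an integer n ≥ 3. The Dirichlet form of the internal tree length φ for the adjacent-swap chain on COM_n with its Tajima stationary distribution π satisfies ℰ(φ) = (1/2) ∑_{x,y ∈ COM_n} (φ(x) − φ(y))² π(x) P(x,y) ≤ 1/2. -/

import Mathlib

open Finset

/-- `p` is an unlabeled constrained ordered matching: each `p k` is a multiset of size two
over the symbols `Fin (n-1)` (symbol `0` stands for a leaf, symbol `j ≠ 0` for the internal
label `j`); across all pairs the symbol `0` appears `n` times and each internal label once;
and the internal label `j` may only appear in pair `p k` (1-indexed pair `k+1`) when 
`j < k + 1`, i.e. `j ≤ k`. -/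
def IsUCOMraw (n : ℕ) (p : Fin (n - 1) → Multiset (Fin (n - 1))) : Prop :=
  (∀ k, Multiset.card (p k) = 2) ∧
  (∀ s : Fin (n - 1), (∑ k, (p k).count s) = if (s : ℕ) = 0 then n else 1) ∧
  (∀ (j k : Fin (n - 1)), (j : ℕ) ≠ 0 → j ∈ p k → (j : ℕ) ≤ (k : ℕ))

instance (n : ℕ) : DecidablePred (IsUCOMraw n) := fun _ => by
  unfold IsUCOMraw; infer_instance

instance (n : ℕ) :
    DecidablePred (fun p : Fin (n - 1) → Sym (Fin (n - 1)) 2 =>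
      IsUCOMraw n (fun k => (p k : Multiset (Fin (n - 1))))) := fun _ => by
  infer_instance

/-- The set of unlabeled constrained ordered matchings `COM_n`; each pair is stored as an
unordered pair with possible repetition (`Sym _ 2`), with the validity predicate imposed on
the underlying multisets. -/
abbrev UCOM (n : ℕ) : Type :=
  {p : Fin (n - 1) → Sym (Fin (n - 1)) 2 //
    IsUCOMraw n (fun k => (p k : Multiset (Fin (n - 1))))}

/-- The sequence of size-two multisets underlying an unlabeled constrained ordered matching. -/
def uraw (n : ℕ) (x : UCOM n) : Fin (n - 1) → Multiset (Fin (n - 1)) :=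
  fun k => (x.val k : Multiset (Fin (n - 1)))

/-- Index of the pair `p_k` (1-indexed `k ∈ {1,…,n-2}`) as an element of `Fin (n-1)`. -/
def idx1 {n : ℕ} (k : Fin (n - 2)) : Fin (n - 1) := ⟨k, by have := k.isLt; omega⟩

/-- Index of the pair `p_{k+1}` as an element of `Fin (n-1)`. -/
def idx2 {n : ℕ} (k : Fin (n - 2)) : Fin (n - 1) := ⟨(k : ℕ) + 1, by have := k.isLt; omega⟩

/-- Result of exchanging symbol `l1` from pair `k` with symbol `l2` from pair `k+1`. -/
def uswapFun (n : ℕ) (p : Fin (n - 1) → Multiset (Fin (n - 1))) (k : Fin (n - 2))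
    (l1 l2 : Fin (n - 1)) : Fin (n - 1) → Multiset (Fin (n - 1)) :=
  fun i =>
    if i = idx1 k then l2 ::ₘ (p (idx1 k)).erase l1
    else if i = idx2 k then l1 ::ₘ (p (idx2 k)).erase l2
    else p i

/-- The state obtained from `x` when attempting to exchange `l1 ∈ p_k` with `l2 ∈ p_{k+1}`:
the swap is performed if it yields a valid constrained ordered matching,
otherwise the chain stays at `x`. -/
def uswapDest (n : ℕ) (x : UCOM n) (k : Fin (n - 2)) (l1 l2 : Fin (n - 1)) :
    Fin (n - 1) → Multiset (Fin (n - 1)) :=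
  if IsUCOMraw n (uswapFun n (uraw n x) k l1 l2) then uswapFun n (uraw n x) k l1 l2
  else uraw n x

/-- Transition matrix of the adjacent-swap Markov chain on `COM_n`:
pick `k ∈ {1,…,n-2}` uniformly, pick `l1` uniformly from the multiset `p_k`
and `l2` uniformly from the multiset `p_{k+1}` (each of the two slots of a pair
with probability 1/2), and swap them if allowed. -/
noncomputable def PU (n : ℕ) (x y : UCOM n) : ℝ :=
  (1 / ((n : ℝ) - 2)) * ∑ k : Fin (n - 2),
    ((uraw n x (idx1 k)).map (fun l1 =>
      ((uraw n x (idx2 k)).map (fun l2 =>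
        (1 / 4 : ℝ) * (if uswapDest n x k l1 l2 = uraw n y then 1 else 0))).sum)).sum

/-- The adjacent-swap transition matrix on `COM_n` as a matrix. -/
noncomputable def PUmat (n : ℕ) : Matrix (UCOM n) (UCOM n) ℝ := Matrix.of (PU n)

/-- The number of cherries of `T`: pairs all of whose elements are the leaf symbol `0`,
i.e. pairs equal to `{0,0}`. -/
def cherries (n : ℕ) (T : UCOM n) : ℕ :=
  (Finset.univ.filter (fun k : Fin (n - 1) => ∀ a ∈ uraw n T k, (a : ℕ) = 0)).card

/-- The Tajima coalescent distribution on `COM_n`. -/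
noncomputable def tajima (n : ℕ) (T : UCOM n) : ℝ :=
  (2 : ℝ) ^ (n - cherries n T - 1) / (Nat.factorial (n - 1))

/-- The (1-indexed, shifted down by one) index of the pair containing the internal label `j`:
`Ix n x j` is the unique `k` (0-indexed) with `j ∈ p_{k+1}`, so that `I_x(j) = Ix n x j + 1`. -/
noncomputable def Ix (n : ℕ) (x : UCOM n) (j : Fin (n - 1)) : ℕ :=
  sInf {k : ℕ | ∃ h : k < n - 1, j ∈ uraw n x ⟨k, h⟩}

/-- The internal tree length `φ(x) = ∑_{j=1}^{n-2} (I_x(j) - j)`. -/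
noncomputable def itl (n : ℕ) (x : UCOM n) : ℤ :=
  ∑ j ∈ Finset.univ.filter (fun j : Fin (n - 1) => (j : ℕ) ≠ 0),
    ((Ix n x j : ℤ) + 1 - (j : ℤ))


def wt : ℕ → ℕ
  | 0 => 1
  | 1 => 2
  | 2 => 2
  | _ => 0

lemma wt_succ (c : ℕ) : wt (c + 1) = wt c * (2 - c) := by
  rcases c with _ | _ | _ | c <;> simp [wt]

def fibc {m N : ℕ} (g : Fin m → Fin N) (k : Fin N) : ℕ := ∑ i, if g i = k then 1 else 0

def W {m N : ℕ} (g : Fin m → Fin N) : ℕ := ∏ k, wt (fibc g k)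

lemma fibc_cons {m N : ℕ} (a : Fin N) (g : Fin m → Fin N) (k : Fin N) :
    fibc (Fin.cons a g : Fin (m+1) → Fin N) k = (if a = k then 1 else 0) + fibc g k := by
  unfold fibc
  rw [Fin.sum_univ_succ]
  simp only [Fin.cons_zero, Fin.cons_succ]

lemma W_cons {m N : ℕ} (a : Fin N) (g : Fin m → Fin N) :
    W (Fin.cons a g : Fin (m+1) → Fin N) = W g * (2 - fibc g a) := by
  unfold W
  rw [← Finset.mul_prod_erase univ _ (Finset.mem_univ a),
    ← Finset.mul_prod_erase univ (fun k => wt (fibc g k)) (Finset.mem_univ a)]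
  have : ∏ k ∈ univ.erase a, wt (fibc (Fin.cons a g : Fin (m+1) → Fin N) k)
      = ∏ k ∈ univ.erase a, wt (fibc g k) := by
    apply Finset.prod_congr rfl
    intro k hk
    rw [fibc_cons, if_neg (Finset.ne_of_mem_erase hk).symm, zero_add]
  rw [this, fibc_cons, if_pos rfl, add_comm 1, wt_succ]
  ring

def Good {m N : ℕ} (g : Fin m → Fin N) : Prop := ∀ i : Fin m, N + (i : ℕ) ≤ (g i : ℕ) + m

lemma good_cons {m N : ℕ} (a : Fin N) (g : Fin m → Fin N) :
    Good (Fin.cons a g : Fin (m+1) → Fin N) ↔ N ≤ (a : ℕ) + (m + 1) ∧ Good g := by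
  unfold Good
  rw [Fin.forall_fin_succ]
  simp only [Fin.cons_zero, Fin.cons_succ, Fin.val_zero, Fin.val_succ, add_zero]
  refine and_congr Iff.rfl (forall_congr' fun i => ?_)
  omega

lemma card_tail {m N : ℕ} (hm : m + 1 ≤ N) :
    (univ.filter (fun a : Fin N => N ≤ (a : ℕ) + (m + 1))).card = m + 1 := by
  have : (univ.filter (fun a : Fin N => N ≤ (a : ℕ) + (m + 1))) =
      Finset.Ici (⟨N - (m+1), by omega⟩ : Fin N) := by
    ext a
    simp [Fin.le_def]
  rw [this, Fin.card_Ici]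
  simp
  omega

lemma step_le {m N : ℕ} (hm : m + 1 ≤ N) (g : Fin m → Fin N) (hg : Good g) :
    ∑ a ∈ univ.filter (fun a : Fin N => N ≤ (a : ℕ) + (m + 1)), W g * (2 - fibc g a)
      ≤ W g * (m + 2) := by
  rw [← Finset.mul_sum]
  by_cases hW : W g = 0
  · simp [hW]
  apply Nat.mul_le_mul_left
  have hc : ∀ k, fibc g k ≤ 2 := by
    intro k
    by_contra h
    apply hW
    apply Finset.prod_eq_zero (Finset.mem_univ k)
    obtain ⟨c, hc⟩ : ∃ c, fibc g k = c + 3 := ⟨fibc g k - 3, by omega⟩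
    rw [hc]; rfl
  have h1 : ∑ a ∈ univ.filter (fun a : Fin N => N ≤ (a : ℕ) + (m + 1)), (2 - fibc g a)
      + ∑ a ∈ univ.filter (fun a : Fin N => N ≤ (a : ℕ) + (m + 1)), fibc g a = 2 * (m + 1) := by
    rw [← Finset.sum_add_distrib, Finset.sum_congr rfl (g := fun _ => 2), Finset.sum_const,
      card_tail hm]
    · simp [mul_comm]
    · intro k _
      have := hc k
      omega
  have h2 : ∑ a ∈ univ.filter (fun a : Fin N => N ≤ (a : ℕ) + (m + 1)), fibc g a = m := by
    unfold fibc
    rw [Finset.sum_comm]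
    rw [Finset.sum_congr rfl (g := fun _ => 1)]
    · simp
    · intro i _
      rw [Finset.sum_ite_eq, if_pos]
      have := hg i
      simp; omega
  omega

open Classical in
lemma main_count (N m : ℕ) (hm : m ≤ N) :
    ∑ g : Fin m → Fin N, (if Good g then W g else 0) ≤ (m + 1).factorial := by
  induction m with
  | zero =>
    rw [Fintype.sum_unique]
    split_ifs <;> simp [W, fibc, wt]
  | succ m ih =>
    rw [← (Fin.consEquiv (fun _ : Fin (m+1) => Fin N)).sum_comp, Fintype.sum_prod_type,
      Finset.sum_comm]
    calc _ ≤ ∑ g : Fin m → Fin N, (if Good g then W g else 0) * (m + 2) := by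
          apply Finset.sum_le_sum
          intro g _
          have e : ∀ a : Fin N, (if Good ((Fin.consEquiv (fun _ : Fin (m+1) => Fin N)) (a, g)) then
              W ((Fin.consEquiv (fun _ : Fin (m+1) => Fin N)) (a, g)) else 0)
              = if N ≤ (a : ℕ) + (m + 1) then (if Good g then W g * (2 - fibc g a) else 0) else 0 := by
            intro a
            have e1 : (Fin.consEquiv (fun _ : Fin (m+1) => Fin N)) (a, g) = Fin.cons a g := rfl
            rw [e1, W_cons]
            simp only [good_cons, ite_and]
          rw [Finset.sum_congr rfl (fun a _ => e a), ← Finset.sum_filter]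
          by_cases hg : Good g
          · simp only [if_pos hg]
            exact step_le hm g hg
          · simp [hg]
      _ = (∑ g : Fin m → Fin N, (if Good g then W g else 0)) * (m + 2) := by
          rw [Finset.sum_mul]
      _ ≤ (m + 1).factorial * (m + 2) := Nat.mul_le_mul_right _ (ih (by omega))
      _ = _ := by rw [Nat.factorial_succ (m+1)]; ring

lemma uraw_inj {n : ℕ} {x y : UCOM n} (h : uraw n x = uraw n y) : x = y := by
  apply Subtype.ext
  funext k
  apply Sym.coe_injective
  exact congrFun h k

lemma ux {n : ℕ} (x : UCOM n) : IsUCOMraw n (uraw n x) := x.2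

lemma exists_pos {n : ℕ} (x : UCOM n) (j : Fin (n-1)) (hj : (j : ℕ) ≠ 0) :
    ∃ k, ∀ k', (uraw n x k').count j = if k' = k then 1 else 0 := by
  have h := (ux x).2.1 j
  rw [if_neg hj] at h
  have hne : ∑ k, (uraw n x k).count j ≠ 0 := by omega
  obtain ⟨k, -, hk⟩ := Finset.exists_ne_zero_of_sum_ne_zero hne
  refine ⟨k, fun k' => ?_⟩
  rw [← Finset.add_sum_erase univ _ (Finset.mem_univ k)] at h
  split_ifs with hkk
  · subst hkk; omega
  · have := Finset.single_le_sum (f := fun k => (uraw n x k).count j) (fun _ _ => Nat.zero_le _)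
      (Finset.mem_erase.2 ⟨hkk, Finset.mem_univ k'⟩)
    omega

open Classical in
noncomputable def pos {n : ℕ} (x : UCOM n) (j : Fin (n-1)) : Fin (n-1) :=
  if hj : (j : ℕ) ≠ 0 then (exists_pos x j hj).choose else j

lemma pos_spec {n : ℕ} (x : UCOM n) (j : Fin (n-1)) (hj : (j : ℕ) ≠ 0) (k' : Fin (n-1)) :
    (uraw n x k').count j = if k' = pos x j then 1 else 0 := by
  unfold pos
  rw [dif_pos hj]
  exact (exists_pos x j hj).choose_spec k'

lemma mem_iff_pos {n : ℕ} (x : UCOM n) (j : Fin (n-1)) (hj : (j : ℕ) ≠ 0) (k' : Fin (n-1)) :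
    j ∈ uraw n x k' ↔ k' = pos x j := by
  rw [← Multiset.count_pos, pos_spec x j hj]
  split_ifs with h <;> simp [h]

lemma Ix_eq {n : ℕ} (x : UCOM n) (j : Fin (n-1)) (hj : (j : ℕ) ≠ 0) :
    Ix n x j = pos x j := by
  have : {k : ℕ | ∃ h : k < n - 1, j ∈ uraw n x ⟨k, h⟩} = {((pos x j : Fin (n-1)) : ℕ)} := by
    ext k
    simp only [Set.mem_ofPred_eq, Set.mem_singleton_iff, mem_iff_pos x j hj]
    constructor
    · rintro ⟨h, e⟩
      rw [← e]
    · intro e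
      subst e
      exact ⟨(pos x j).2, rfl⟩
  rw [Ix, this, csInf_singleton]

lemma count_split {n : ℕ} (x : UCOM n) (z k : Fin (n-1)) (hz : (z : ℕ) = 0) :
    (uraw n x k).count z + ∑ j ∈ univ.filter (fun j : Fin (n - 1) => (j : ℕ) ≠ 0),
      (uraw n x k).count j = 2 := by
  have h1 := (ux x).1 k
  have h2 := Multiset.sum_count_eq_card (s := univ) (m := uraw n x k) (fun a _ => Finset.mem_univ a)
  have h3 : univ.filter (fun j : Fin (n - 1) => (j : ℕ) ≠ 0) = univ.erase z := by
    ext a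
    simp [Fin.ext_iff, hz]
  rw [h3, Finset.add_sum_erase univ (fun j => (uraw n x k).count j) (Finset.mem_univ z), h2, h1]

lemma itl_eq {n : ℕ} (x : UCOM n) (z : Fin (n-1)) (hz : (z : ℕ) = 0) :
    itl n x = ∑ k : Fin (n-1), (k : ℤ) * (2 - ((uraw n x k).count z : ℤ)) +
      ∑ j ∈ Finset.univ.filter (fun j : Fin (n - 1) => (j : ℕ) ≠ 0), (1 - (j : ℤ)) := by
  have h1 : ∀ k : Fin (n-1), (k : ℤ) * (2 - ((uraw n x k).count z : ℤ))
      = ∑ j ∈ univ.filter (fun j : Fin (n - 1) => (j : ℕ) ≠ 0),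
        (k : ℤ) * ((uraw n x k).count j : ℤ) := by
    intro k
    rw [← Finset.mul_sum]
    have := count_split x z k hz
    have h : (2 : ℤ) = ((uraw n x k).count z : ℤ) + ∑ j ∈ univ.filter (fun j : Fin (n - 1) => (j : ℕ) ≠ 0),
      ((uraw n x k).count j : ℤ) := by exact_mod_cast this.symm
    rw [h]; ring
  rw [Finset.sum_congr rfl (fun k _ => h1 k), Finset.sum_comm, ← Finset.sum_add_distrib]
  unfold itl
  apply Finset.sum_congr rfl
  intro j hj
  have hj' : (j : ℕ) ≠ 0 := by simpa using hj
  have : ∑ k : Fin (n-1), (k : ℤ) * ((uraw n x k).count j : ℤ) = (pos x j : ℤ) := by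
    simp [pos_spec x j hj']
  rw [this, Ix_eq x j hj']
  ring

lemma idx_ne {n : ℕ} (k : Fin (n-2)) : idx1 k ≠ idx2 k := by
  simp [idx1, idx2, Fin.ext_iff]

lemma itl_diff {n : ℕ} (x y : UCOM n) (k : Fin (n-2)) (l1 l2 : Fin (n-1))
    (h1 : l1 ∈ uraw n x (idx1 k)) (h2 : l2 ∈ uraw n x (idx2 k))
    (h : uswapDest n x k l1 l2 = uraw n y) : ((itl n x : ℝ) - (itl n y : ℝ)) ^ 2 ≤ 1 := by
  unfold uswapDest at h
  split_ifs at h with hv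
  swap
  · rw [uraw_inj h]; simp
  have hk := k.2
  let z : Fin (n-1) := ⟨0, by omega⟩
  have hz : (z : ℕ) = 0 := rfl
  set d : ℤ := (if l2 = z then 1 else 0) - (if l1 = z then 1 else 0) with hd
  have e1 : ((uraw n y (idx1 k)).count z : ℤ) = (uraw n x (idx1 k)).count z + d := by
    have a : uraw n y (idx1 k) = l2 ::ₘ (uraw n x (idx1 k)).erase l1 := by
      rw [← h]; simp [uswapFun]
    have b : (uraw n x (idx1 k)).count z = (l1 ::ₘ (uraw n x (idx1 k)).erase l1).count z := by
      rw [Multiset.cons_erase h1]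
    rw [a, b, Multiset.count_cons, Multiset.count_cons, hd]
    simp only [eq_comm (a := z)]
    push_cast
    ring
  have e2 : ((uraw n y (idx2 k)).count z : ℤ) = (uraw n x (idx2 k)).count z - d := by
    have a : uraw n y (idx2 k) = l1 ::ₘ (uraw n x (idx2 k)).erase l2 := by
      rw [← h]; simp [uswapFun, (idx_ne k).symm]
    have b : (uraw n x (idx2 k)).count z = (l2 ::ₘ (uraw n x (idx2 k)).erase l2).count z := by
      rw [Multiset.cons_erase h2]
    rw [a, b, Multiset.count_cons, Multiset.count_cons, hd]
    simp only [eq_comm (a := z)]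
    push_cast
    ring
  have e3 : ∀ i, i ≠ idx1 k → i ≠ idx2 k → uraw n y i = uraw n x i := by
    intro i hi hi'
    rw [← h]; simp [uswapFun, hi, hi']
  have hdiff : itl n x - itl n y = - d := by
    rw [itl_eq x z hz, itl_eq y z hz, add_sub_add_right_eq_sub, ← Finset.sum_sub_distrib]
    rw [Finset.sum_eq_add (idx1 k) (idx2 k) (idx_ne k)]
    · rw [e1, e2]
      simp only [idx1, idx2]
      push_cast
      ring
    · rintro c - ⟨hc1, hc2⟩
      rw [e3 c hc1 hc2]; ring
    · simp
    · simp
  have : ((itl n x : ℝ) - (itl n y : ℝ)) = ((-d : ℤ) : ℝ) := by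
    rw [← hdiff]; push_cast; ring
  rw [this, hd]
  split_ifs <;> norm_num

lemma row_bound {n : ℕ} (hn : 3 ≤ n) (x : UCOM n) :
    ∑ y : UCOM n, ((itl n x : ℝ) - (itl n y : ℝ)) ^ 2 * PU n x y ≤ 1 := by
  have hn2 : (0 : ℝ) < (n : ℝ) - 2 := by
    have : (3 : ℝ) ≤ n := by exact_mod_cast hn
    linarith
  let D : UCOM n → ℝ := fun y => ((itl n x : ℝ) - (itl n y : ℝ)) ^ 2
  have hsum : ∀ (M : Multiset (Fin (n-1))) (F : UCOM n → Fin (n-1) → ℝ) (a : ℝ),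
      (∀ l ∈ M, ∑ y, F y l ≤ a) → ∑ y, (M.map (F y)).sum ≤ Multiset.card M * a := by
    intro M F a hM
    induction M using Multiset.induction_on with
    | empty => simp
    | cons l M ih =>
      simp only [Multiset.map_cons, Multiset.sum_cons, Finset.sum_add_distrib, Multiset.card_cons]
      have := ih (fun l hl => hM l (Multiset.mem_cons_of_mem hl))
      have := hM l (Multiset.mem_cons_self l M)
      push_cast
      linarith
  have key : ∀ k : Fin (n-2), ∑ y, D y * ((uraw n x (idx1 k)).map (fun l1 =>
      ((uraw n x (idx2 k)).map (fun l2 =>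
        (1 / 4 : ℝ) * (if uswapDest n x k l1 l2 = uraw n y then 1 else 0))).sum)).sum ≤ 1 := by
    intro k
    simp only [← Multiset.sum_map_mul_left]
    refine (hsum _ _ (1/2) ?_).trans ?_
    · intro l1 h1
      refine (hsum _ _ (1/4) ?_).trans ?_
      · intro l2 h2
        by_cases hex : ∃ y, uswapDest n x k l1 l2 = uraw n y
        · obtain ⟨y, hy⟩ := hex
          rw [Finset.sum_eq_single y]
          · rw [if_pos hy]
            have := itl_diff x y k l1 l2 h1 h2 hy
            simp only [D]
            linarith
          · intro y' _ hne
            rw [if_neg]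
            · simp
            · intro h
              exact hne (uraw_inj (h.symm.trans hy))
          · simp
        · push Not at hex
          simp [hex]
      · rw [(ux x).1]; norm_num
    · rw [(ux x).1]; norm_num
  have : ∑ y : UCOM n, ((itl n x : ℝ) - (itl n y : ℝ)) ^ 2 * PU n x y
      = (1 / ((n : ℝ) - 2)) * ∑ k : Fin (n-2), ∑ y, D y * ((uraw n x (idx1 k)).map (fun l1 =>
      ((uraw n x (idx2 k)).map (fun l2 =>
        (1 / 4 : ℝ) * (if uswapDest n x k l1 l2 = uraw n y then 1 else 0))).sum)).sum := by
    rw [Finset.sum_comm, Finset.mul_sum]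
    apply Finset.sum_congr rfl
    intro y _
    rw [← Finset.mul_sum]
    unfold PU
    simp only [D]
    ring
  rw [this]
  have hs := Finset.sum_le_sum (s := univ) (fun k _ => key k)
  have hc : ∑ k : Fin (n-2), (1 : ℝ) = (n : ℝ) - 2 := by
    simp
    rw [Nat.cast_sub (by omega)]; norm_num
  rw [hc] at hs
  rw [one_div, inv_mul_le_iff₀ hn2]
  linarith

noncomputable def gx {n : ℕ} (x : UCOM n) : Fin (n-2) → Fin (n-1) := fun j => pos x (idx2 j)

lemma sum_nz {n : ℕ} (f : Fin (n-1) → ℕ) :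
    ∑ j ∈ univ.filter (fun j : Fin (n - 1) => (j : ℕ) ≠ 0), f j = ∑ j : Fin (n-2), f (idx2 j) := by
  symm
  apply Finset.sum_bij (fun j _ => idx2 j)
  · intro a _
    simp [idx2]
  · intro a _ b _ h
    simpa [idx2, Fin.ext_iff] using h
  · intro b hb
    have hb' : (b : ℕ) ≠ 0 := by simpa using hb
    have := b.2
    exact ⟨⟨(b : ℕ) - 1, by omega⟩, Finset.mem_univ _, by simp [idx2, Fin.ext_iff]; omega⟩
  · intros; rfl

lemma idx2_ne {n : ℕ} (j : Fin (n-2)) : ((idx2 j : Fin (n-1)) : ℕ) ≠ 0 := by simp [idx2]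

lemma fibc_gx {n : ℕ} (x : UCOM n) (z k : Fin (n-1)) (hz : (z : ℕ) = 0) :
    (uraw n x k).count z + fibc (gx x) k = 2 := by
  refine Eq.trans ?_ (count_split x z k hz)
  rw [sum_nz]
  congr 1
  unfold fibc gx
  apply Finset.sum_congr rfl
  intro j _
  rw [pos_spec x _ (idx2_ne j)]
  simp only [eq_comm]

lemma gx_good {n : ℕ} (hn : 3 ≤ n) (x : UCOM n) : Good (gx x) := by
  intro i
  have := (ux x).2.2 (idx2 i) (pos x (idx2 i)) (idx2_ne i)
    ((mem_iff_pos x _ (idx2_ne i) _).2 rfl)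
  simp only [idx2] at this
  unfold gx
  simp only [idx2]
  omega

lemma gx_inj {n : ℕ} (hn : 3 ≤ n) : Function.Injective (gx (n := n)) := by
  intro x y h
  apply uraw_inj
  funext k
  ext s
  by_cases hs : (s : ℕ) = 0
  · have h1 := fibc_gx x s k hs
    have h2 := fibc_gx y s k hs
    rw [h] at h1
    omega
  · have e : s = idx2 ⟨(s : ℕ) - 1, by have := s.2; omega⟩ := by
      simp [idx2, Fin.ext_iff]; omega
    rw [pos_spec x s hs, pos_spec y s hs]
    have : pos x s = pos y s := by
      rw [e]
      exact congrFun h _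
    rw [this]

lemma weight_eq {n : ℕ} (hn : 3 ≤ n) (x : UCOM n) :
    2 ^ (n - cherries n x - 1) = W (gx x) := by
  let z : Fin (n-1) := ⟨0, by omega⟩
  have hz : (z : ℕ) = 0 := rfl
  have h1 : ∀ k, wt (fibc (gx x) k) = if (∀ a ∈ uraw n x k, (a : ℕ) = 0) then 1 else 2 := by
    intro k
    have hf := fibc_gx x z k hz
    have hcard := (ux x).1 k
    have hiff : (∀ a ∈ uraw n x k, (a : ℕ) = 0) ↔ (uraw n x k).count z = 2 := by
      rw [← hcard, Multiset.count_eq_card]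
      refine forall₂_congr fun a _ => ?_
      rw [Fin.ext_iff, hz, eq_comm]
    simp only [hiff]
    have : fibc (gx x) k = 0 ∨ fibc (gx x) k = 1 ∨ fibc (gx x) k = 2 := by omega
    rcases this with h | h | h
    · rw [h, if_pos (by omega)]; rfl
    · rw [h, if_neg (by omega)]; rfl
    · rw [h, if_neg (by omega)]; rfl
  unfold W
  rw [Finset.prod_congr rfl (fun k _ => h1 k), Finset.prod_ite]
  simp only [Finset.prod_const, one_pow, one_mul]
  congr 1
  have := Finset.card_filter_add_card_filter_not (s := (univ : Finset (Fin (n-1))))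
    (fun k => ∀ a ∈ uraw n x k, (a : ℕ) = 0)
  rw [Finset.card_univ, Fintype.card_fin] at this
  unfold cherries
  omega

lemma tajima_sum {n : ℕ} (hn : 3 ≤ n) : ∑ x : UCOM n, tajima n x ≤ 1 := by
  classical
  unfold tajima
  rw [← Finset.sum_div, div_le_one (by positivity)]
  have h := main_count (n-1) (n-2) (by omega)
  have e : n - 2 + 1 = n - 1 := by omega
  rw [e] at h
  have h2 : ∑ x : UCOM n, 2 ^ (n - cherries n x - 1)
      ≤ ∑ g : Fin (n-2) → Fin (n-1), (if Good g then W g else 0) := by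
    calc _ = ∑ x : UCOM n, (if Good (gx x) then W (gx x) else 0) := by
          apply Finset.sum_congr rfl
          intro x _
          rw [if_pos (gx_good hn x), weight_eq hn]
      _ = ∑ g ∈ univ.map ⟨gx, gx_inj hn⟩, (if Good g then W g else 0) := by
          rw [Finset.sum_map]; rfl
      _ ≤ _ := Finset.sum_le_sum_of_subset (Finset.subset_univ _)
  exact_mod_cast h2.trans h


/-- For `n ≥ 3`, the Dirichlet form of the internal tree length `φ` for the
adjacent-swap chain on `COM_n` with Tajima stationary distribution satisfies `ℰ(φ) ≤ 1/2`. -/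
theorem stmt11 (n : ℕ) (hn : 3 ≤ n) :
    (1 / 2 : ℝ) * ∑ x : UCOM n, ∑ y : UCOM n,
        ((itl n x : ℝ) - (itl n y : ℝ)) ^ 2 * tajima n x * PU n x y
      ≤ 1 / 2 := by
  have h : ∑ x : UCOM n, ∑ y : UCOM n,
        ((itl n x : ℝ) - (itl n y : ℝ)) ^ 2 * tajima n x * PU n x y ≤ 1 := by
    refine le_trans (Finset.sum_le_sum (g := fun x => tajima n x) ?_) (tajima_sum hn)
    intro x _
    have e : ∑ y : UCOM n, ((itl n x : ℝ) - (itl n y : ℝ)) ^ 2 * tajima n x * PU n x y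
        = tajima n x * ∑ y : UCOM n, ((itl n x : ℝ) - (itl n y : ℝ)) ^ 2 * PU n x y := by
      rw [Finset.mul_sum]
      apply Finset.sum_congr rfl
      intro y _
      ring
    rw [e]
    have ht : 0 ≤ tajima n x := by unfold tajima; positivity
    have := mul_le_mul_of_nonneg_left (row_bound hn x) ht
    linarith
  linarith
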